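/- Let Ω = ℝ^d/ℤ^d, let T > 0, m ∈ ℕ*, and α_1,…,α_m > 0, and let 𝓟_T^{m,∞} = { p ∈ (W^{m,∞}([0,T]))^d : p([0,T]) ⊂ Ω, ‖p^{(i)}‖_∞ ≤ α_i for i = 1,…,m }. Then 𝓟_T^{m,∞} is compact for the topology of pointwise convergence: every sequence (p_n) in 𝓟_T^{m,∞} converging pointwise has its limit in 𝓟_T^{m,∞}, and every sequence in 𝓟_T^{m,∞} admits a pointwise-convergent subsequence. Consequently, for any continuous h with ĥ(ξ) ≠ 0 for all ξ and any Borel probability measure π on Ω, the problem inf_{μ ∈ 𝓜(𝓟_T^{m,∞})} N_h(μ − π) over pushforward measures μ = p_*γ_T (γ_T the normalized Lebesgue measure on [0,T]) admits at least one solution. -/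

import Mathlib

open MeasureTheory Filter Topology
open scoped NNReal ENNReal

noncomputable section

/-- The `d`-dimensional torus `Ω = ℝ^d/ℤ^d`. -/
abbrev Torus (d : ℕ) : Type := Fin d → AddCircle (1 : ℝ)

/-- Convolution `(h ⋆ μ)(x) = ∫ h(x−y) dμ(y)` of a function with a finite signed
measure, via the Jordan decomposition of `μ`. -/
def convSigned {d : ℕ} (h : Torus d → ℝ) (μ : SignedMeasure (Torus d)) (x : Torus d) : ℝ :=
  ∫ y, h (x - y) ∂μ.toJordanDecomposition.posPart -
    ∫ y, h (x - y) ∂μ.toJordanDecomposition.negPart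

/-- `N_h(μ) = ‖h ⋆ μ‖_{L²(Ω)}` for a signed measure `μ`. -/
def nhSigned {d : ℕ} (h : Torus d → ℝ) (μ : SignedMeasure (Torus d)) : ℝ :=
  Real.sqrt (∫ x, (convSigned h μ x) ^ 2)

/-- The total variation norm `‖μ‖_TV` of a signed measure. -/
def tvNorm {d : ℕ} (μ : SignedMeasure (Torus d)) : ℝ := (μ.totalVariation Set.univ).toReal

/-- The integral `∫ f dμ` of a function against a signed measure. -/
def signedIntegral {d : ℕ} (μ : SignedMeasure (Torus d)) (f : Torus d → ℝ) : ℝ :=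
  ∫ y, f y ∂μ.toJordanDecomposition.posPart - ∫ y, f y ∂μ.toJordanDecomposition.negPart

/-- The Fourier coefficient `ĥ(ξ) = ∫_Ω e^{−2πi⟨ξ,x⟩} h(x) dx`, `ξ ∈ ℤ^d`. -/
def torusFourierCoeff {d : ℕ} (h : Torus d → ℝ) (ξ : Fin d → ℤ) : ℂ :=
  ∫ x : Torus d, (∏ i, fourier (-(ξ i)) (x i)) * (h x : ℂ)

/-- `(h ⋆ (μ − ν))(x)` for two (finite) measures `μ, ν`. -/
def convDiff {d : ℕ} (h : Torus d → ℝ) (μ ν : Measure (Torus d)) (x : Torus d) : ℝ :=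
  ∫ y, h (x - y) ∂μ - ∫ y, h (x - y) ∂ν

/-- `N_h(μ − ν) = ‖h ⋆ (μ − ν)‖_{L²(Ω)}`. -/
def nhDist {d : ℕ} (h : Torus d → ℝ) (μ ν : Measure (Torus d)) : ℝ :=
  Real.sqrt (∫ x, (convDiff h μ ν x) ^ 2)

/-- The L¹ Wasserstein (Kantorovich) distance: infimum of `∫ dist(x,y) dc` over
all couplings `c` of `μ` and `ν`. -/
def W1 {d : ℕ} (μ ν : Measure (Torus d)) : ℝ :=
  sInf { r | ∃ c : Measure (Torus d × Torus d),
    c.map Prod.fst = μ ∧ c.map Prod.snd = ν ∧ r = ∫ p, dist p.1 p.2 ∂c }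

/-- The set `𝓜(Ω^N)` of `N`-point measures `(1/N) ∑ δ_{p_i}`. -/
def nPointMeasures (d N : ℕ) : Set (Measure (Torus d)) :=
  { μ | ∃ p : Fin N → Torus d, μ = (N : ℝ≥0∞)⁻¹ • ∑ i, Measure.dirac (p i) }

/-- Hausdorff distance between two sets of measures with respect to the metric
`(μ, ν) ↦ N_h(μ − ν)`. -/
def hausNh {d : ℕ} (h : Torus d → ℝ) (A B : Set (Measure (Torus d))) : ℝ :=
  max (sSup ((fun μ => sInf ((fun ν => nhDist h μ ν) '' B)) '' A))
      (sSup ((fun ν => sInf ((fun μ => nhDist h μ ν) '' A)) '' B))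

/-- Coordinatewise projection `ℝ^d → ℝ^d/ℤ^d`. -/
def projT {d : ℕ} (v : EuclideanSpace ℝ (Fin d)) : Torus d :=
  fun i => (v i : AddCircle (1 : ℝ))

/-- The admissible curve set `𝓟_T^{m,∞}`: torus-valued curves on `[0,T]` admitting a lift
`p ∈ (W^{m,∞}([0,T]))^d` (i.e. `p ∈ C^{m-1}` with `α_m`-Lipschitz `(m−1)`-th derivative,
which is exactly `W^{m,∞}` with `‖p^{(m)}‖_∞ ≤ α_m`) such that `‖p^{(i)}‖_∞ ≤ α_i` for
`i = 1, …, m`. -/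
def InP (d : ℕ) (T : ℝ) (m : ℕ) (α : ℕ → ℝ) (q : ℝ → Torus d) : Prop :=
  ∃ p : ℝ → EuclideanSpace ℝ (Fin d),
    (∀ t ∈ Set.Icc 0 T, q t = projT (p t)) ∧
    ContDiffOn ℝ (m - 1) p (Set.Icc 0 T) ∧
    (∀ i, 1 ≤ i → i ≤ m - 1 →
      ∀ t ∈ Set.Icc 0 T, ‖iteratedDerivWithin i p (Set.Icc 0 T) t‖ ≤ α i) ∧
    LipschitzOnWith (Real.toNNReal (α m))
      (iteratedDerivWithin (m - 1) p (Set.Icc 0 T)) (Set.Icc 0 T)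

/-- `γ_T`: the uniform (normalized Lebesgue) probability measure on `[0, T]`. -/
def gammaT (T : ℝ) : Measure ℝ := (ENNReal.ofReal T)⁻¹ • (volume.restrict (Set.Icc 0 T))

/-- A family `F 0, …, F n` of curves on `[0, T]` in which each curve is the derivative of the
preceding one, with `F 1, …, F n` bounded by `α 1, …, α n` and each `F i` Lipschitz with constant
`α (i + 1)`. The derivative relation is encoded by a Taylor estimate, so that all the conditions
are closed under pointwise convergence. -/
structure IsJet {E : Type*} [NormedAddCommGroup E] [NormedSpace ℝ E] (n : ℕ) (T : ℝ)
    (α : ℕ → ℝ) (F : ℕ → ℝ → E) : Prop where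
  lip : ∀ i ≤ n, ∀ s ∈ Set.Icc 0 T, ∀ t ∈ Set.Icc 0 T, ‖F i t - F i s‖ ≤ α (i + 1) * |t - s|
  taylor : ∀ i < n, ∀ s ∈ Set.Icc 0 T, ∀ t ∈ Set.Icc 0 T,
    ‖F i t - F i s - (t - s) • F (i + 1) s‖ ≤ α (i + 2) * |t - s| * |t - s|
  bound : ∀ i, 1 ≤ i → i ≤ n → ∀ t ∈ Set.Icc 0 T, ‖F i t‖ ≤ α i

namespace IsJet

variable {E : Type*} [NormedAddCommGroup E] [NormedSpace ℝ E] {n : ℕ} {T : ℝ} {α : ℕ → ℝ}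
  {F : ℕ → ℝ → E}

theorem of_tendsto {G : ℕ → ℕ → ℝ → E} (hG : ∀ k, IsJet n T α (G k))
    (h : ∀ i ≤ n, ∀ t ∈ Set.Icc 0 T, Tendsto (fun k => G k i t) atTop (𝓝 (F i t))) :
    IsJet n T α F where
  lip i hi s hs t ht :=
    le_of_tendsto ((h i hi t ht).sub (h i hi s hs)).norm
      (Eventually.of_forall fun k => (hG k).lip i hi s hs t ht)
  taylor i hi s hs t ht :=
    le_of_tendsto (((h i hi.le t ht).sub (h i hi.le s hs)).sub
      ((h (i + 1) hi s hs).const_smul (t - s))).norm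
      (Eventually.of_forall fun k => (hG k).taylor i hi s hs t ht)
  bound i h1 hi t ht :=
    le_of_tendsto (h i hi t ht).norm (Eventually.of_forall fun k => (hG k).bound i h1 hi t ht)

theorem of_hasDerivWithinAt
    (hderiv : ∀ i < n, ∀ t ∈ Set.Icc 0 T, HasDerivWithinAt (F i) (F (i + 1) t) (Set.Icc 0 T) t)
    (hbound : ∀ i, 1 ≤ i → i ≤ n → ∀ t ∈ Set.Icc 0 T, ‖F i t‖ ≤ α i)
    (hlip : ∀ s ∈ Set.Icc 0 T, ∀ t ∈ Set.Icc 0 T, ‖F n t - F n s‖ ≤ α (n + 1) * |t - s|) :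
    IsJet n T α F := by
  have lip : ∀ i ≤ n, ∀ s ∈ Set.Icc 0 T, ∀ t ∈ Set.Icc 0 T,
      ‖F i t - F i s‖ ≤ α (i + 1) * |t - s| := by
    intro i hi s hs t ht
    rcases hi.lt_or_eq with hi | rfl
    · exact (convex_Icc 0 T).norm_image_sub_le_of_norm_hasDerivWithin_le (hderiv i hi)
        (hbound (i + 1) (by omega) hi) hs ht
    · exact hlip s hs t ht
  refine ⟨lip, fun i hi s hs t ht => ?_, hbound⟩
  have hsub : Set.uIcc s t ⊆ Set.Icc 0 T := Set.uIcc_subset_Icc hs ht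
  have hα : 0 ≤ α (i + 2) * |t - s| := (norm_nonneg _).trans (lip (i + 1) hi s hs t ht)
  have hderiv' : ∀ u ∈ Set.uIcc s t, HasDerivWithinAt (fun u => F i u - u • F (i + 1) s)
      (F (i + 1) u - F (i + 1) s) (Set.uIcc s t) u := fun u hu => by
    have := ((hderiv i hi u (hsub hu)).mono hsub).sub
      ((hasDerivWithinAt_id u _).smul_const (F (i + 1) s))
    rwa [one_smul] at this
  have hb : ∀ u ∈ Set.uIcc s t, ‖F (i + 1) u - F (i + 1) s‖ ≤ α (i + 2) * |t - s| := by
    intro u hu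
    rcases eq_or_ne t s with rfl | hne
    · obtain rfl : u = t := by simpa using hu
      simp
    have hpos : 0 < |t - s| := abs_pos.2 (sub_ne_zero.2 hne)
    exact (lip (i + 1) hi s hs u (hsub hu)).trans (mul_le_mul_of_nonneg_left
      (Set.abs_sub_left_of_mem_uIcc hu) (nonneg_of_mul_nonneg_left hα hpos))
  have := (convex_uIcc s t).norm_image_sub_le_of_norm_hasDerivWithin_le hderiv' hb
    Set.left_mem_uIcc Set.right_mem_uIcc
  rw [Real.norm_eq_abs] at this
  convert this using 2
  rw [sub_smul]
  abel

theorem hasDerivWithinAt (hF : IsJet n T α F) {i : ℕ} (hi : i < n) {t : ℝ}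
    (ht : t ∈ Set.Icc 0 T) : HasDerivWithinAt (F i) (F (i + 1) t) (Set.Icc 0 T) t := by
  rw [hasDerivWithinAt_iff_isLittleO]
  have hO : (fun x => F i x - F i t - (x - t) • F (i + 1) t) =O[𝓝[Set.Icc 0 T] t]
      fun x => ‖x - t‖ ^ 2 := by
    refine Asymptotics.IsBigO.of_bound (α (i + 2)) ?_
    filter_upwards [self_mem_nhdsWithin] with x hx
    refine (hF.taylor i hi t ht x hx).trans_eq ?_
    rw [norm_pow, norm_norm, Real.norm_eq_abs]
    ring
  refine hO.trans_isLittleO (Asymptotics.IsLittleO.mono ?_ nhdsWithin_le_nhds)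
  exact Asymptotics.isLittleO_pow_sub_sub t one_lt_two

theorem continuousOn (hF : IsJet n T α F) {i : ℕ} (hi : i ≤ n) :
    ContinuousOn (F i) (Set.Icc 0 T) :=
  (LipschitzOnWith.of_dist_le' (K := α (i + 1)) fun t ht s hs => by
    rw [dist_eq_norm, Real.dist_eq]
    exact hF.lip i hi s hs t ht).continuousOn

theorem iteratedDerivWithin_eqOn (hF : IsJet n T α F) (hT : 0 < T) {i : ℕ} (hi : i ≤ n) :
    Set.EqOn (iteratedDerivWithin i (F 0) (Set.Icc 0 T)) (F i) (Set.Icc 0 T) := by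
  induction i with
  | zero => simp [iteratedDerivWithin_zero, Set.EqOn]
  | succ i ih =>
    intro t ht
    rw [iteratedDerivWithin_succ, derivWithin_congr (ih (by omega)) (ih (by omega) ht)]
    exact (hF.hasDerivWithinAt hi ht).derivWithin (uniqueDiffOn_Icc hT t ht)

theorem contDiffOn (hF : IsJet n T α F) (hT : 0 < T) : ContDiffOn ℝ n (F 0) (Set.Icc 0 T) := by
  refine contDiffOn_of_continuousOn_differentiableOn_deriv (n := (n : ℕ∞)) ?_ ?_
  · intro i hi
    have hi : i ≤ n := by exact_mod_cast hi
    exact (hF.continuousOn hi).congr (hF.iteratedDerivWithin_eqOn hT hi)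
  · intro i hi
    have hi : i < n := by exact_mod_cast hi
    exact DifferentiableOn.congr (fun t ht => (hF.hasDerivWithinAt hi ht).differentiableWithinAt)
      (hF.iteratedDerivWithin_eqOn hT hi.le)

theorem sub_const_zeroth (hF : IsJet n T α F) (v : E) :
    IsJet n T α (Function.update F 0 fun t => F 0 t - v) where
  lip i hi s hs t ht := by
    rcases i with _ | i
    · simpa using hF.lip 0 hi s hs t ht
    · simpa using hF.lip (i + 1) hi s hs t ht
  taylor i hi s hs t ht := by
    rcases i with _ | i
    · simpa using hF.taylor 0 hi s hs t ht
    · simpa using hF.taylor (i + 1) hi s hs t ht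
  bound i h1 hi t ht := by
    rw [Function.update_of_ne (by omega)]
    exact hF.bound i h1 hi t ht

/-- Sequential compactness of the jets starting in a fixed ball. -/
theorem exists_subseq_tendsto [ProperSpace E] (hT : 0 < T) {R : ℝ} {G : ℕ → ℕ → ℝ → E}
    (hG : ∀ k, IsJet n T α (G k)) (hR : ∀ k, ‖G k 0 0‖ ≤ R) :
    ∃ φ : ℕ → ℕ, StrictMono φ ∧ ∃ F : ℕ → ℝ → E, IsJet n T α F ∧
      ∀ i ≤ n, ∀ t ∈ Set.Icc 0 T, Tendsto (fun k => G (φ k) i t) atTop (𝓝 (F i t)) := by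
  have h0 : (0 : ℝ) ∈ Set.Icc 0 T := ⟨le_rfl, hT.le⟩
  obtain ⟨A, hA⟩ : ∃ A, ∀ i ∈ Finset.range (n + 2), |α i| ≤ A := by
    obtain ⟨A, hA⟩ := ((Finset.range (n + 2)).image fun i => |α i|).bddAbove
    exact ⟨A, fun i hi => hA (Finset.mem_coe.2 (Finset.mem_image_of_mem _ hi))⟩
  have hA0 : 0 ≤ A := (abs_nonneg _).trans (hA 0 (by simp))
  have hR0 : 0 ≤ R := (norm_nonneg _).trans (hR 0)
  let f (k : ℕ) (t : Set.Icc (0 : ℝ) T) : Fin (n + 1) → E := fun i => G k i t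
  have hf_lip : ∀ k s t, dist (f k s) (f k t) ≤ A * dist s t := by
    intro k s t
    refine (dist_pi_le_iff (by positivity)).2 fun i => ?_
    rw [dist_eq_norm, Subtype.dist_eq, Real.dist_eq]
    refine ((hG k).lip i (by omega) t t.2 s s.2).trans ?_
    gcongr
    exact (le_abs_self _).trans (hA _ (Finset.mem_range.2 (by omega)))
  have hf_bound : ∀ k t, f k t ∈ Metric.closedBall (0 : Fin (n + 1) → E) (R + A * T + A) := by
    intro k t
    rw [mem_closedBall_zero_iff]
    refine (pi_norm_le_iff_of_nonneg (by positivity)).2 fun i => ?_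
    rcases Nat.eq_zero_or_pos (i : ℕ) with hi | hi
    · have h1 := (hG k).lip 0 (Nat.zero_le n) 0 h0 t t.2
      have h2 : α (0 + 1) * |(t : ℝ) - 0| ≤ A * T := by
        rw [sub_zero, abs_of_nonneg t.2.1]
        exact mul_le_mul ((le_abs_self _).trans (hA _ (by simp))) t.2.2 t.2.1 hA0
      have h3 : ‖G k 0 t‖ ≤ ‖G k 0 t - G k 0 0‖ + ‖G k 0 0‖ := norm_le_norm_sub_add _ _
      simp only [f, hi]
      linarith [hR k]
    · have h1 := (hG k).bound i hi (by omega) t t.2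
      have h2 := (le_abs_self _).trans (hA i (Finset.mem_range.2 (by omega)))
      have h3 : 0 ≤ A * T := by positivity
      simp only [f]
      linarith
  let g (k : ℕ) : BoundedContinuousFunction (Set.Icc (0 : ℝ) T) (Fin (n + 1) → E) :=
    BoundedContinuousFunction.mkOfCompact
      ⟨f k, (LipschitzWith.of_dist_le' (hf_lip k)).continuous⟩
  have hcompact : IsCompact (closure (Set.range g)) := by
    refine BoundedContinuousFunction.arzela_ascoli _ (isCompact_closedBall 0 (R + A * T + A)) _
      ?_ ?_
    · rintro _ t ⟨k, rfl⟩
      exact hf_bound k t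
    · refine Metric.equicontinuous_of_continuity_modulus (fun r => A * r) ?_ _ ?_
      · simpa using (continuous_const_mul A).tendsto 0
      · rintro s t ⟨_, k, rfl⟩
        exact hf_lip k s t
  obtain ⟨a, -, φ, hφ, ha⟩ := hcompact.tendsto_subseq fun k => subset_closure ⟨k, rfl⟩
  have hlim : ∀ i (hi : i ≤ n) t (ht : t ∈ Set.Icc 0 T),
      Tendsto (fun k => G (φ k) i t) atTop (𝓝 (a ⟨t, ht⟩ ⟨i, by omega⟩)) := fun i hi t ht =>
    ((continuous_apply (⟨i, by omega⟩ : Fin (n + 1))).tendsto _).comp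
      (((continuous_eval_const (⟨t, ht⟩ : Set.Icc (0 : ℝ) T)).tendsto a).comp ha)
  let F (i : ℕ) (t : ℝ) : E :=
    if h : i ≤ n ∧ t ∈ Set.Icc 0 T then a ⟨t, h.2⟩ ⟨i, by omega⟩ else 0
  have hF : ∀ i ≤ n, ∀ t ∈ Set.Icc 0 T, Tendsto (fun k => G (φ k) i t) atTop (𝓝 (F i t)) := by
    intro i hi t ht
    simp only [F, dif_pos (And.intro hi ht)]
    exact hlim i hi t ht
  exact ⟨φ, hφ, F, of_tendsto (fun k => hG (φ k)) hF, hF⟩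

end IsJet

section Curves

variable {d : ℕ} {T : ℝ} {α : ℕ → ℝ}

theorem inP_succ_iff_exists_isJet {n : ℕ} (hT : 0 < T) (hα : 0 < α (n + 1)) {q : ℝ → Torus d} :
    InP d T (n + 1) α q ↔ ∃ F : ℕ → ℝ → EuclideanSpace ℝ (Fin d), IsJet n T α F ∧
      ∀ t ∈ Set.Icc 0 T, q t = projT (F 0 t) := by
  have hcast : (((n + 1 : ℕ) : WithTop ℕ∞) - 1) = (n : WithTop ℕ∞) := by
    have : ((n + 1 : ℕ) : ℕ∞) - 1 = n := by exact_mod_cast Nat.add_sub_cancel n 1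
    exact (WithTop.coe_sub (a := ((n + 1 : ℕ) : ℕ∞)) (b := 1)).symm.trans (congrArg _ this)
  constructor
  · rintro ⟨p, hq, hp, hbound, hlip⟩
    rw [hcast] at hp
    refine ⟨fun i => iteratedDerivWithin i p (Set.Icc 0 T), .of_hasDerivWithinAt ?_ hbound ?_, ?_⟩
    · intro i hi t ht
      rw [iteratedDerivWithin_succ]
      exact (hp.differentiableOn_iteratedDerivWithin (by exact_mod_cast hi) (uniqueDiffOn_Icc hT)
        t ht).hasDerivWithinAt
    · intro s hs t ht
      have := hlip.dist_le_mul t ht s hs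
      rwa [Real.coe_toNNReal _ hα.le, dist_eq_norm, Real.dist_eq] at this
    · simpa using hq
  · rintro ⟨F, hF, hq⟩
    refine ⟨F 0, hq, ?_, ?_, ?_⟩
    · rw [hcast]
      exact hF.contDiffOn hT
    · intro i h1 hi t ht
      rw [hF.iteratedDerivWithin_eqOn hT hi ht]
      exact hF.bound i h1 hi t ht
    · refine LipschitzOnWith.of_dist_le' fun t ht s hs => ?_
      rw [Nat.add_sub_cancel, hF.iteratedDerivWithin_eqOn hT le_rfl ht,
        hF.iteratedDerivWithin_eqOn hT le_rfl hs, dist_eq_norm, Real.dist_eq]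
      exact hF.lip n le_rfl s hs t ht

theorem continuous_projT : Continuous (projT : EuclideanSpace ℝ (Fin d) → Torus d) :=
  continuous_pi fun i => continuous_quotient_mk'.comp (by fun_prop)

theorem exists_projT_sub_eq (x : EuclideanSpace ℝ (Fin d)) :
    ∃ v, (∀ y, projT (y - v) = projT y) ∧ ‖x - v‖ ≤ √d := by
  refine ⟨WithLp.toLp 2 fun i => (⌊x i⌋ : ℝ), fun y => funext fun i => ?_, ?_⟩
  · simp [projT]
  · rw [EuclideanSpace.norm_eq]
    refine Real.sqrt_le_sqrt ?_
    calc ∑ i, ‖(x - WithLp.toLp 2 fun i => (⌊x i⌋ : ℝ)) i‖ ^ 2 ≤ ∑ _i : Fin d, (1 : ℝ) := by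
          refine Finset.sum_le_sum fun i _ => ?_
          simp only [PiLp.sub_apply, Int.self_sub_floor, Real.norm_eq_abs, sq_abs]
          exact pow_le_one₀ (Int.fract_nonneg _) (Int.fract_lt_one _).le
      _ = d := by simp

theorem InP.congr {m : ℕ} {q q' : ℝ → Torus d} (h : InP d T m α q)
    (hqq' : ∀ t ∈ Set.Icc 0 T, q' t = q t) : InP d T m α q' := by
  obtain ⟨p, hp, hrest⟩ := h
  exact ⟨p, fun t ht => (hqq' t ht).trans (hp t ht), hrest⟩

theorem InP.continuousOn {m : ℕ} {q : ℝ → Torus d} (h : InP d T m α q) :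
    ContinuousOn q (Set.Icc 0 T) := by
  obtain ⟨p, hp, hcont, -⟩ := h
  exact (continuous_projT.comp_continuousOn hcont.continuousOn).congr hp

theorem exists_inP {m : ℕ} (hm : 1 ≤ m) (hT : 0 < T) (hα : ∀ i, 1 ≤ i → i ≤ m → 0 < α i) :
    ∃ q : ℝ → Torus d, InP d T m α q := by
  obtain ⟨n, rfl⟩ := Nat.exists_eq_add_of_le' hm
  refine ⟨fun _ => projT 0, (inP_succ_iff_exists_isJet hT (hα _ hm le_rfl)).2
    ⟨fun _ _ => 0, .of_hasDerivWithinAt (fun _ _ t _ => hasDerivWithinAt_const t _ 0) ?_ ?_,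
      fun _ _ => rfl⟩⟩
  · intro i h1 hi t _
    simpa using (hα i h1 (by omega)).le
  · intro s _ t _
    have := (hα (n + 1) hm le_rfl).le
    simp only [sub_self, norm_zero]
    positivity

theorem exists_subseq_tendsto_inP {m : ℕ} (hm : 1 ≤ m) (hT : 0 < T)
    (hα : ∀ i, 1 ≤ i → i ≤ m → 0 < α i) {pn : ℕ → ℝ → Torus d}
    (hpn : ∀ k, InP d T m α (pn k)) :
    ∃ φ : ℕ → ℕ, StrictMono φ ∧ ∃ q : ℝ → Torus d, InP d T m α q ∧
      ∀ t ∈ Set.Icc 0 T, Tendsto (fun k => pn (φ k) t) atTop (𝓝 (q t)) := by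
  obtain ⟨n, rfl⟩ := Nat.exists_eq_add_of_le' hm
  have hα' := hα (n + 1) hm le_rfl
  have key : ∀ k, ∃ F : ℕ → ℝ → EuclideanSpace ℝ (Fin d), IsJet n T α F ∧
      (∀ t ∈ Set.Icc 0 T, pn k t = projT (F 0 t)) ∧ ‖F 0 0‖ ≤ √d := by
    intro k
    obtain ⟨F, hF, hq⟩ := (inP_succ_iff_exists_isJet hT hα').1 (hpn k)
    obtain ⟨v, hv, hnorm⟩ := exists_projT_sub_eq (F 0 0)
    refine ⟨_, hF.sub_const_zeroth v, fun t ht => ?_, ?_⟩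
    · rw [Function.update_self, hv, hq t ht]
    · rwa [Function.update_self]
  choose G hG hproj hnorm using key
  obtain ⟨φ, hφ, F, hF, hlim⟩ := IsJet.exists_subseq_tendsto hT hG hnorm
  refine ⟨φ, hφ, fun t => projT (F 0 t),
    (inP_succ_iff_exists_isJet hT hα').2 ⟨F, hF, fun _ _ => rfl⟩, fun t ht => ?_⟩
  simp only [fun k => hproj (φ k) t ht]
  exact (continuous_projT.tendsto _).comp (hlim 0 (Nat.zero_le n) t ht)

theorem isFiniteMeasure_gammaT (hT : 0 < T) : IsFiniteMeasure (gammaT T) :=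
  Measure.smul_finite _ (by simpa using hT)

theorem aemeasurable_gammaT_of_continuousOn {q : ℝ → Torus d}
    (hq : ContinuousOn q (Set.Icc 0 T)) : AEMeasurable q (gammaT T) :=
  (hq.aemeasurable measurableSet_Icc).smul_measure _

theorem continuous_integral_comp_sub (h : C(Torus d, ℝ)) (μ : Measure (Torus d))
    [IsFiniteMeasure μ] : Continuous fun x => ∫ y, h (x - y) ∂μ :=
  continuous_of_dominated (bound := fun _ => ‖h‖)
    (fun x => (by fun_prop : Continuous fun y => h (x - y)).aestronglyMeasurable)
    (fun _ => Eventually.of_forall fun _ => h.norm_coe_le_norm _) (integrable_const _)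
    (Eventually.of_forall fun y => by fun_prop)

theorem continuous_convDiff (h : C(Torus d, ℝ)) (μ ν : Measure (Torus d))
    [IsFiniteMeasure μ] [IsFiniteMeasure ν] : Continuous (convDiff h μ ν) :=
  (continuous_integral_comp_sub h μ).sub (continuous_integral_comp_sub h ν)

/-- `N_h(p_*γ - π)` is continuous in `p` for almost everywhere convergence. -/
theorem tendsto_nhDist_map {X : Type*} [MeasurableSpace X] {γ : Measure X} [IsFiniteMeasure γ]
    (h : C(Torus d, ℝ)) (π : Measure (Torus d)) [IsFiniteMeasure π] {pn : ℕ → X → Torus d}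
    {q : X → Torus d} (hpn : ∀ k, AEMeasurable (pn k) γ) (hq : AEMeasurable q γ)
    (hlim : ∀ᵐ t ∂γ, Tendsto (fun k => pn k t) atTop (𝓝 (q t))) :
    Tendsto (fun k => nhDist h (γ.map (pn k)) π) atTop (𝓝 (nhDist h (γ.map q) π)) := by
  have hmap : ∀ (p : X → Torus d), AEMeasurable p γ → ∀ x,
      ∫ y, h (x - y) ∂(γ.map p) = ∫ t, h (x - p t) ∂γ := fun p hp x =>
    integral_map hp (by fun_prop : Continuous fun y => h (x - y)).aestronglyMeasurable
  have hconv : ∀ x, Tendsto (fun k => convDiff h (γ.map (pn k)) π x) atTop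
      (𝓝 (convDiff h (γ.map q) π x)) := by
    intro x
    simp only [convDiff, hmap _ hq, fun k => hmap _ (hpn k)]
    refine Tendsto.sub_const ?_ _
    refine tendsto_integral_of_dominated_convergence (fun _ => ‖h‖) (fun k => ?_)
      (integrable_const _) (fun _ => Eventually.of_forall fun _ => h.norm_coe_le_norm _) ?_
    · exact ((by fun_prop : Continuous fun y => h (x - y)).measurable.comp_aemeasurable
        (hpn k)).aestronglyMeasurable
    · filter_upwards [hlim] with t ht
      exact ((by fun_prop : Continuous fun y => h (x - y)).tendsto _).comp ht
  have hbound : ∀ k x, |convDiff h (γ.map (pn k)) π x| ≤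
      ‖h‖ * γ.real Set.univ + ‖h‖ * π.real Set.univ := by
    intro k x
    simp only [convDiff, hmap _ (hpn k)]
    refine (abs_sub _ _).trans (add_le_add ?_ ?_) <;>
      exact norm_integral_le_of_norm_le_const (Eventually.of_forall fun _ => h.norm_coe_le_norm _)
  refine (Real.continuous_sqrt.tendsto _).comp ?_
  refine tendsto_integral_of_dominated_convergence
    (fun _ => (‖h‖ * γ.real Set.univ + ‖h‖ * π.real Set.univ) ^ 2) (fun k => ?_)
    (integrable_const _) (fun k => Eventually.of_forall fun x => ?_)
    (Eventually.of_forall fun x => (hconv x).pow 2)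
  · exact ((continuous_convDiff h _ π).pow 2).aestronglyMeasurable
  · rw [Real.norm_eq_abs, abs_pow]
    exact pow_le_pow_left₀ (abs_nonneg _) (hbound k x) 2

end Curves

/-- The set `𝓟_T^{m,∞}` is compact for the topology of pointwise
convergence (on `[0,T]`): it is closed under pointwise limits and every sequence admits a
pointwise-convergent subsequence.  Consequently, for any continuous `h` with nonvanishing
Fourier coefficients and any probability measure `π`, the projection problem
`inf_{μ ∈ 𝓜(𝓟_T^{m,∞})} N_h(μ − π)` over pushforward measures `μ = p_*γ_T` admits a
solution. -/
theorem curves_compact_and_projection_exists {d : ℕ} (m : ℕ) (hm : 1 ≤ m)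
    (T : ℝ) (hT : 0 < T) (α : ℕ → ℝ) (hα : ∀ i, 1 ≤ i → i ≤ m → 0 < α i) :
    (∀ (pn : ℕ → ℝ → Torus d) (q : ℝ → Torus d), (∀ k, InP d T m α (pn k)) →
        (∀ t ∈ Set.Icc 0 T, Tendsto (fun k => pn k t) atTop (𝓝 (q t))) →
        InP d T m α q) ∧
      (∀ pn : ℕ → ℝ → Torus d, (∀ k, InP d T m α (pn k)) →
        ∃ φ : ℕ → ℕ, StrictMono φ ∧ ∃ q : ℝ → Torus d, InP d T m α q ∧
          ∀ t ∈ Set.Icc 0 T, Tendsto (fun k => pn (φ k) t) atTop (𝓝 (q t))) ∧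
      ∀ h : C(Torus d, ℝ), (∀ ξ : Fin d → ℤ, torusFourierCoeff (⇑h) ξ ≠ 0) →
        ∀ π : Measure (Torus d), IsProbabilityMeasure π →
          ∃ q : ℝ → Torus d, InP d T m α q ∧
            ∀ q' : ℝ → Torus d, InP d T m α q' →
              nhDist (⇑h) ((gammaT T).map q) π ≤ nhDist (⇑h) ((gammaT T).map q') π := by
  refine ⟨fun pn q hpn hlim => ?_, fun pn hpn => exists_subseq_tendsto_inP hm hT hα hpn,
    fun h _ π _ => ?_⟩
  · obtain ⟨φ, hφ, q', hq', hlim'⟩ := exists_subseq_tendsto_inP hm hT hα hpn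
    exact hq'.congr fun t ht =>
      tendsto_nhds_unique ((hlim t ht).comp hφ.tendsto_atTop) (hlim' t ht)
  · have := isFiniteMeasure_gammaT hT
    let N (q : ℝ → Torus d) : ℝ := nhDist h ((gammaT T).map q) π
    have hbdd : BddBelow (N '' {q | InP d T m α q}) :=
      ⟨0, by rintro _ ⟨q, -, rfl⟩; exact Real.sqrt_nonneg _⟩
    obtain ⟨u, -, hu, hmem⟩ :=
      exists_seq_tendsto_sInf (Set.Nonempty.image N (exists_inP (d := d) hm hT hα)) hbdd
    choose pn hpn hN using hmem
    obtain ⟨φ, hφ, q, hq, hlim⟩ := exists_subseq_tendsto_inP hm hT hα hpn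
    have hlimN : Tendsto (fun k => N (pn (φ k))) atTop (𝓝 (N q)) :=
      tendsto_nhDist_map h π
        (fun k => aemeasurable_gammaT_of_continuousOn (InP.continuousOn (hpn (φ k))))
        (aemeasurable_gammaT_of_continuousOn hq.continuousOn)
        (Measure.ae_smul_measure (ae_restrict_of_forall_mem measurableSet_Icc hlim) _)
    have hNq : N q = sInf (N '' {q | InP d T m α q}) :=
      tendsto_nhds_unique (hlimN.congr fun k => hN (φ k)) (hu.comp hφ.tendsto_atTop)
    exact ⟨q, hq, fun q' hq' => hNq.trans_le (csInf_le hbdd ⟨q', hq', rfl⟩)⟩
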